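/- arXiv:1108.1910 — 2 statements merged into one kernel-verified Lean document; each statement's English description precedes it below -/
import Mathlib

section
/- Fix i ∈ {1,…,d} and let A_1,…,A_n be nonempty closed convex sets in ℝ^d such that dom δ*_{A_k} is a compactly i-generated cone for each k, and suppose A := ∩_{k=1}^n A_k is nonempty. Then δ*_A = conv{δ*_{A_1},…,δ*_{A_n}}, and for each x ∈ σ_i(dom δ*_A) there exist α_1,…,α_n ≥ 0 and points x_k ∈ σ_i(dom δ*_{A_k}) such that Σ_k α_k = 1, Σ_k α_k x_k = x, and δ*_A(x) = Σ_k α_k δ*_{A_k}(x_k). Moreover dom δ*_A is a compactly i-generated cone and dom δ*_A = conv[∪_{k=1}^n dom δ*_{A_k}]. -/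
open Finset MeasureTheory
open scoped Pointwise

namespace RZpaper

/-- Portfolio space `ℝ^d`. -/
abbrev V (d : ℕ) : Type := Fin d → ℝ

/-- Euclidean scalar product on `ℝ^d`. -/
def vdot {d : ℕ} (x y : V d) : ℝ := ∑ j, x j * y j

/-- The `i`-th standard basis vector `e^i` of `ℝ^d`. -/
def eV {d : ℕ} (i : Fin d) : V d := Pi.single i 1

/-- A probability measure on a finite sample space, given by its weights. -/
structure Prob (Ω : Type*) [Fintype Ω] where
  w : Ω → ℝ
  nonneg : ∀ ω, 0 ≤ w ω
  total : ∑ ω, w ω = 1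

/-- `g` is a version of the conditional expectation `E_P(X | m)` on a finite space. -/
def IsCondExp {Ω : Type*} [Fintype Ω] {E : Type*} [AddCommMonoid E] [Module ℝ E]
    [MeasurableSpace E] (P : Prob Ω) (m : MeasurableSpace Ω) (X g : Ω → E) : Prop :=
  Measurable[m] g ∧ ∀ A : Set Ω, MeasurableSet[m] A →
    (∑ ω, A.indicator (fun ω' => P.w ω' • g ω') ω) =
      ∑ ω, A.indicator (fun ω' => P.w ω' • X ω') ω

/-- The atom (node) of the σ-algebra `m` containing `ω`. -/
def node {Ω : Type*} (m : MeasurableSpace Ω) (ω : Ω) : Set Ω :=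
  {ω' | ∀ A : Set Ω, MeasurableSet[m] A → ω ∈ A → ω' ∈ A}

/-- `E*_t := ∪_{s=t}^T E_s`. -/
def EStar {Ω : Type*} (T : ℕ) (E : ℕ → Set Ω) (t : ℕ) : Set Ω :=
  ⋃ s ∈ Finset.Icc t T, E s

/-- `R` is a set of representatives for the atoms of `m` contained in `μ`:
each point of `μ` belongs to the node of exactly one member of `R`. -/
def Transversal {Ω : Type*} (m : MeasurableSpace Ω) (μ : Set Ω) (R : Finset Ω) : Prop :=
  (∀ r ∈ R, r ∈ μ) ∧ ∀ ω' ∈ μ, ∃! r, r ∈ R ∧ ω' ∈ node m r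

/-- Support function `δ*_A : ℝ^d → ℝ ∪ {∞}` of a set `A ⊆ ℝ^d` (with values in `EReal`). -/
noncomputable def sfn {d : ℕ} (A : Set (V d)) (x : V d) : EReal :=
  sSup ((fun y => ((vdot x y : ℝ) : EReal)) '' A)

/-- Effective domain of an `EReal`-valued function. -/
def edom {d : ℕ} (f : V d → EReal) : Set (V d) := {x | f x ≠ ⊤}

/-- `σ_i(A) := {x ∈ A : x^i = 1}`. -/
def sig {d : ℕ} (i : Fin d) (A : Set (V d)) : Set (V d) := {x ∈ A | x i = 1}

/-- The cone generated by `A`. -/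
def cone0 {d : ℕ} (A : Set (V d)) : Set (V d) :=
  {x | ∃ c : ℝ, 0 ≤ c ∧ ∃ y ∈ A, x = c • y}

/-- A cone `C` is compactly `i`-generated if `σ_i(C)` is compact, nonempty
and `C = cone σ_i(C)`. -/
def CompactlyGen {d : ℕ} (i : Fin d) (C : Set (V d)) : Prop :=
  (sig i C).Nonempty ∧ IsCompact (sig i C) ∧ C = cone0 (sig i C)

/-- A polyhedral cone: nonnegative combinations of finitely many vectors. -/
def IsPolyCone {d : ℕ} (C : Set (V d)) : Prop :=
  ∃ (n : ℕ) (v : Fin n → V d),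
    C = {x | ∃ c : Fin n → ℝ, (∀ k, 0 ≤ c k) ∧ x = ∑ k, c k • v k}

/-- Convex hull of two extended-real-valued functions, via the infimum formula. -/
noncomputable def fconv2 {d : ℕ} (g h : V d → EReal) (x : V d) : EReal :=
  sInf {r : EReal | ∃ (a b : ℝ) (xg xh : V d), 0 ≤ a ∧ 0 ≤ b ∧ a + b = 1 ∧
    a • xg + b • xh = x ∧ r = (a : EReal) * g xg + (b : EReal) * h xh}

/-- Convex hull of a finite family of extended-real-valued functions, via the
infimum formula. -/
noncomputable def fconvF {d : ℕ} {ι : Type*} (s : Finset ι) (g : ι → V d → EReal)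
    (x : V d) : EReal :=
  sInf {r : EReal | ∃ (α : ι → ℝ) (p : ι → V d), (∀ k, 0 ≤ α k) ∧ (∑ k ∈ s, α k) = 1 ∧
    (∑ k ∈ s, α k • p k) = x ∧ r = ∑ k ∈ s, ((α k : ℝ) : EReal) * g k (p k)}

/-- The randomised stopping time `χ^τ` associated with an ordinary stopping time `τ`. -/
def chiOf {Ω : Type*} (τ : Ω → ℕ) : ℕ → Ω → ℝ := fun t ω => if τ ω = t then 1 else 0

/-- Kabanov's currency market model with proportional transaction costs on a finite
probability space: a filtration `F` on time horizon `T` with `F 0` trivial and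
`F T = ⊤`, and an adapted matrix-valued exchange rate process `pi` with positive
entries. -/
structure Market (Ω : Type*) [Fintype Ω] (T d : ℕ) where
  F : ℕ → MeasurableSpace Ω
  F_mono : ∀ s t : ℕ, s ≤ t → F s ≤ F t
  F_zero : F 0 = ⊥
  F_top : F T = ⊤
  pi : ℕ → Ω → Fin d → Fin d → ℝ
  pi_pos : ∀ t, t ≤ T → ∀ ω i j, 0 < pi t ω i j
  pi_adapted : ∀ t, t ≤ T → Measurable[F t] (pi t)

namespace Market

variable {Ω : Type*} [Fintype Ω] {T d : ℕ}

/-- The ω-wise solvency cone `S_t(ω) = L_t^+ − K_t` at time `t`: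
portfolios that can be exchanged into a nonnegative portfolio. -/
def solvency (M : Market Ω T d) (t : ℕ) (ω : Ω) : Set (V d) :=
  {x | ∃ β : Fin d → Fin d → ℝ, (∀ i j, 0 ≤ β i j) ∧
    ∀ j, 0 ≤ x j + (∑ i, β i j) - ∑ i, β j i * M.pi t ω j i}

/-- The ω-wise dual cone `S_t^*(ω)` of the solvency cone. -/
def dualCone (M : Market Ω T d) (t : ℕ) (ω : Ω) : Set (V d) :=
  {y | ∀ x ∈ M.solvency t ω, 0 ≤ vdot y x}

/-- Self-financing (predictable) trading strategies. -/
def SelfFinancing (M : Market Ω T d) (y : ℕ → Ω → V d) : Prop :=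
  (∀ t, t ≤ T → Measurable[M.F (t - 1)] (y t)) ∧
  ∀ t, t < T → ∀ ω, y t ω - y (t + 1) ω ∈ M.solvency t ω

/-- The weak no-arbitrage property `(NA^w)`. -/
def WNA (M : Market Ω T d) : Prop :=
  {z : Ω → V d | ∃ y, M.SelfFinancing y ∧ (∀ ω, y 0 ω = 0) ∧ y T = z} ∩
    {z : Ω → V d | ∀ ω j, 0 ≤ z ω j} = {0}

/-- Adapted `ℝ^d`-valued process. -/
def Adapted (M : Market Ω T d) (ξ : ℕ → Ω → V d) : Prop :=
  ∀ t, t ≤ T → Measurable[M.F t] (ξ t)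

/-- Stopping times with values in `{0, …, T}`. -/
def IsStop (M : Market Ω T d) (τ : Ω → ℕ) : Prop :=
  (∀ ω, τ ω ≤ T) ∧ ∀ t : ℕ, MeasurableSet[M.F t] {ω | τ ω = t}

/-- Randomised stopping times. -/
def IsRStop (M : Market Ω T d) (χ : ℕ → Ω → ℝ) : Prop :=
  (∀ t, t ≤ T → Measurable[M.F t] (χ t)) ∧ (∀ t, t ≤ T → ∀ ω, 0 ≤ χ t ω) ∧
  ∀ ω, ∑ t ∈ Finset.range (T + 1), χ t ω = 1

/-- Exercise policies. -/
def IsPolicy (M : Market Ω T d) (E : ℕ → Set Ω) : Prop :=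
  (∀ t, t ≤ T → MeasurableSet[M.F t] (E t)) ∧
  (∀ t, t < T → MeasurableSet[M.F t] (⋃ s ∈ Finset.Icc (t + 1) T, E s)) ∧
  (⋃ t ∈ Finset.range (T + 1), E t) = Set.univ

/-- Ordinary stopping times consistent with the exercise policy `E`, i.e. `τ ∈ T^E`. -/
def ConsStop (M : Market Ω T d) (E : ℕ → Set Ω) (τ : Ω → ℕ) : Prop :=
  M.IsStop τ ∧ ∀ t : ℕ, {ω | τ ω = t} ⊆ E t

/-- Randomised stopping times consistent with the exercise policy `E`, i.e. `χ ∈ X^E`. -/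
def ConsRStop (M : Market Ω T d) (E : ℕ → Set Ω) (χ : ℕ → Ω → ℝ) : Prop :=
  M.IsRStop χ ∧ ∀ t, t ≤ T → {ω | 0 < χ t ω} ⊆ E t

/-- `ζ` is measurable with respect to the σ-algebra `F_τ` of the stopping time `τ`. -/
def MeasStopped (M : Market Ω T d) (τ : Ω → ℕ) (ζ : Ω → V d) : Prop :=
  ∀ s : Set (V d), MeasurableSet s → ∀ t : ℕ, MeasurableSet[M.F t] (ζ ⁻¹' s ∩ {ω | τ ω = t})

/-- `S^{χ*}_t := ∑_{s=t}^T χ_s S_s` (so `S^{χ*}_{T+1} = 0`). -/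
noncomputable def schi (M : Market Ω T d) (χ : ℕ → Ω → ℝ) (S : ℕ → Ω → V d) (t : ℕ) :
    Ω → V d :=
  fun ω => ∑ s ∈ Finset.Icc t T, χ s ω • S s ω

/-- `(P, S)` is a `χ`-approximate martingale pair: `S_t ∈ S_t^* \ {0}` and
`E_P(S^{χ*}_{t+1} | F_t)` has a version with values in `S_t^*`, for all `t ≤ T`. -/
def ApproxPair (M : Market Ω T d) (χ : ℕ → Ω → ℝ) (P : Prob Ω) (S : ℕ → Ω → V d) : Prop :=
  (∀ t, t ≤ T → Measurable[M.F t] (S t)) ∧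
  (∀ t, t ≤ T → ∀ ω, S t ω ∈ M.dualCone t ω ∧ S t ω ≠ 0) ∧
  ∀ t, t ≤ T → ∃ g : Ω → V d, IsCondExp P (M.F t) (M.schi χ S (t + 1)) g ∧
    ∀ ω, g ω ∈ M.dualCone t ω

/-- Membership of `P̄^i(χ)`: a `χ`-approximate martingale pair with `S^i ≡ 1`. -/
def ApproxPairI (M : Market Ω T d) (i : Fin d) (χ : ℕ → Ω → ℝ) (P : Prob Ω)
    (S : ℕ → Ω → V d) : Prop :=
  M.ApproxPair χ P S ∧ ∀ t, t ≤ T → ∀ ω, S t ω i = 1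

/-- Membership of `P^i(χ)`: a `χ`-approximate *equivalent* martingale pair with `S^i ≡ 1`. -/
def EqvApproxPairI (M : Market Ω T d) (i : Fin d) (χ : ℕ → Ω → ℝ) (P : Prob Ω)
    (S : ℕ → Ω → V d) : Prop :=
  M.ApproxPairI i χ P S ∧ ∀ ω, 0 < P.w ω

/-- Membership of `P̄^i`: `S` is a `P`-martingale with `S_t ∈ S_t^* \ {0}` and `S^i ≡ 1`. -/
def MartPairI (M : Market Ω T d) (i : Fin d) (P : Prob Ω) (S : ℕ → Ω → V d) : Prop :=
  (∀ t, t ≤ T → Measurable[M.F t] (S t)) ∧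
  (∀ t, t < T → IsCondExp P (M.F t) (S (t + 1)) (S t)) ∧
  (∀ t, t ≤ T → ∀ ω, S t ω ∈ M.dualCone t ω ∧ S t ω ≠ 0) ∧
  (∀ t, t ≤ T → ∀ ω, S t ω i = 1)

/-- `E_P((ξ·S)_χ)`. -/
noncomputable def expVal (M : Market Ω T d) (P : Prob Ω) (ξ S : ℕ → Ω → V d)
    (χ : ℕ → Ω → ℝ) : ℝ :=
  ∑ ω, P.w ω * ∑ t ∈ Finset.range (T + 1), χ t ω * vdot (ξ t ω) (S t ω)

/-- The covering condition for the seller: `y_τ − ξ_τ ∈ S_τ` for all `τ ∈ T^E`. -/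
def SellerCovers (M : Market Ω T d) (E : ℕ → Set Ω) (ξ y : ℕ → Ω → V d) : Prop :=
  ∀ τ : Ω → ℕ, M.ConsStop E τ → ∀ ω, y (τ ω) ω - ξ (τ ω) ω ∈ M.solvency (τ ω) ω

/-- `y` superhedges the option `(ξ, E)` for the seller. -/
def SellerHedge (M : Market Ω T d) (E : ℕ → Set Ω) (ξ y : ℕ → Ω → V d) : Prop :=
  M.SelfFinancing y ∧ M.SellerCovers E ξ y

/-- The ask (seller's) price of `(ξ, E)` in currency `i`. -/
noncomputable def ask (M : Market Ω T d) (E : ℕ → Set Ω) (ξ : ℕ → Ω → V d) (i : Fin d) : ℝ :=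
  sInf {x : ℝ | ∃ y, M.SellerHedge E ξ y ∧ ∀ ω, y 0 ω = x • eV i}

/-- The covering condition for the buyer: `y_τ + ξ_τ ∈ S_τ`. -/
def BuyerCovers (M : Market Ω T d) (ξ y : ℕ → Ω → V d) (τ : Ω → ℕ) : Prop :=
  ∀ ω, y (τ ω) ω + ξ (τ ω) ω ∈ M.solvency (τ ω) ω

/-- `(y, τ)` superhedges the option `(ξ, E)` for the buyer. -/
def BuyerHedge (M : Market Ω T d) (E : ℕ → Set Ω) (ξ y : ℕ → Ω → V d) (τ : Ω → ℕ) : Prop :=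
  M.SelfFinancing y ∧ M.ConsStop E τ ∧ M.BuyerCovers ξ y τ

/-- The bid (buyer's) price of `(ξ, E)` in currency `i`. -/
noncomputable def bid (M : Market Ω T d) (E : ℕ → Set Ω) (ξ : ℕ → Ω → V d) (i : Fin d) : ℝ :=
  sSup {r : ℝ | ∃ y τ, M.BuyerHedge E ξ y τ ∧ ∀ ω, y 0 ω = (-r) • eV i}

open scoped Classical in
/-- `U^a_t := ξ_t + S_t` on `E_t`, `ℝ^d` off `E_t` (ω-wise). -/
noncomputable def Ua (M : Market Ω T d) (E : ℕ → Set Ω) (ξ : ℕ → Ω → V d) (t : ℕ) (ω : Ω) :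
    Set (V d) :=
  if ω ∈ E t then {ξ t ω} + M.solvency t ω else Set.univ

/-- Backward recursion for the seller's construction, indexed by `k = T − t`. -/
noncomputable def ZaAux (M : Market Ω T d) (E : ℕ → Set Ω) (ξ : ℕ → Ω → V d) :
    ℕ → Ω → Set (V d)
  | 0 => M.Ua E ξ T
  | (k + 1) => fun ω =>
      M.Ua E ξ (T - (k + 1)) ω ∩
        ({v | ∀ ω' ∈ node (M.F (T - (k + 1))) ω, v ∈ M.ZaAux E ξ k ω'} +
          M.solvency (T - (k + 1)) ω)

/-- The seller's sets `Z^a_t` (ω-wise), via Construction A. -/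
noncomputable def Za (M : Market Ω T d) (E : ℕ → Set Ω) (ξ : ℕ → Ω → V d) (t : ℕ) :
    Ω → Set (V d) := M.ZaAux E ξ (T - t)

open scoped Classical in
/-- The seller's sets `W^a_t = Z^a_{t+1} ∩ L_t` (ω-wise), with `W^a_T = L_T`. -/
noncomputable def Wa (M : Market Ω T d) (E : ℕ → Set Ω) (ξ : ℕ → Ω → V d) (t : ℕ) (ω : Ω) :
    Set (V d) :=
  if t < T then {v | ∀ ω' ∈ node (M.F t) ω, v ∈ M.Za E ξ (t + 1) ω'} else Set.univ

open scoped Classical in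
/-- The seller's sets `V^a_t = W^a_t + S_t` (ω-wise), with `V^a_T = L_T`. -/
noncomputable def Va (M : Market Ω T d) (E : ℕ → Set Ω) (ξ : ℕ → Ω → V d) (t : ℕ) (ω : Ω) :
    Set (V d) :=
  if t < T then M.Wa E ξ t ω + M.solvency t ω else Set.univ

/-- `Z^a_0` as a subset of `ℝ^d` (recall `F_0` is trivial). -/
noncomputable def Za0 (M : Market Ω T d) (E : ℕ → Set Ω) (ξ : ℕ → Ω → V d) : Set (V d) :=
  {v | ∀ ω, v ∈ M.Za E ξ 0 ω}

open scoped Classical in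
/-- `U^b_t := −ξ_t + S_t` on `E_t`, `∅` off `E_t` (ω-wise). -/
noncomputable def Ub (M : Market Ω T d) (E : ℕ → Set Ω) (ξ : ℕ → Ω → V d) (t : ℕ) (ω : Ω) :
    Set (V d) :=
  if ω ∈ E t then {-(ξ t ω)} + M.solvency t ω else ∅

/-- Backward recursion for the buyer's construction, indexed by `k = T − t`. -/
noncomputable def ZbAux (M : Market Ω T d) (E : ℕ → Set Ω) (ξ : ℕ → Ω → V d) :
    ℕ → Ω → Set (V d)
  | 0 => M.Ub E ξ T
  | (k + 1) => fun ω =>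
      M.Ub E ξ (T - (k + 1)) ω ∪
        ({v | ∀ ω' ∈ node (M.F (T - (k + 1))) ω, v ∈ M.ZbAux E ξ k ω'} +
          M.solvency (T - (k + 1)) ω)

/-- The buyer's sets `Z^b_t` (ω-wise), via Construction B. -/
noncomputable def Zb (M : Market Ω T d) (E : ℕ → Set Ω) (ξ : ℕ → Ω → V d) (t : ℕ) :
    Ω → Set (V d) := M.ZbAux E ξ (T - t)

/-- `Z^b_0` as a subset of `ℝ^d` (recall `F_0` is trivial). -/
noncomputable def Zb0 (M : Market Ω T d) (E : ℕ → Set Ω) (ξ : ℕ → Ω → V d) : Set (V d) :=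
  {v | ∀ ω, v ∈ M.Zb E ξ 0 ω}

end Market

section Vdot

variable {d : ℕ}

lemma vdot_add_left (x x' y : V d) : vdot (x + x') y = vdot x y + vdot x' y :=
  add_dotProduct x x' y

lemma vdot_smul_left (c : ℝ) (x y : V d) : vdot (c • x) y = c * vdot x y :=
  smul_dotProduct c x y

lemma vdot_sub_right (x y y' : V d) : vdot x (y - y') = vdot x y - vdot x y' :=
  dotProduct_sub x y y'

lemma vdot_smul_right (c : ℝ) (x y : V d) : vdot x (c • y) = c * vdot x y :=
  dotProduct_smul c x y

lemma vdot_zero_left (y : V d) : vdot 0 y = 0 := zero_dotProduct y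

lemma vdot_sum_left {ι : Type*} (s : Finset ι) (x : ι → V d) (y : V d) :
    vdot (∑ k ∈ s, x k) y = ∑ k ∈ s, vdot (x k) y :=
  sum_dotProduct s x y

lemma continuous_vdot_left (y : V d) : Continuous fun x : V d => vdot x y := by
  unfold vdot
  fun_prop

/-- Every linear functional on `ℝ^d` is a scalar product. -/
lemma linearMap_eq_vdot (f : V d →ₗ[ℝ] ℝ) (x : V d) :
    f x = vdot x fun j => f (Pi.single j 1) := by
  conv_lhs => rw [← Finset.univ_sum_single x, map_sum]
  refine Finset.sum_congr rfl fun j _ => ?_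
  rw [← smul_eq_mul, ← map_smul, ← Pi.single_smul', smul_eq_mul, mul_one]

end Vdot

/-- A linear map that is injective at the origin on a closed cone sends it to a closed set. -/
lemma isClosed_image_of_cone {E F : Type*} [NormedAddCommGroup E] [NormedSpace ℝ E]
    [FiniteDimensional ℝ E] [NormedAddCommGroup F] [NormedSpace ℝ F] {Q : Set E}
    (hQ : IsClosed Q) (hsmul : ∀ c : ℝ, 0 ≤ c → ∀ q ∈ Q, c • q ∈ Q) (L : E →L[ℝ] F)
    (hker : ∀ q ∈ Q, L q = 0 → q = 0) : IsClosed (L '' Q) := by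
  have : ProperSpace E := FiniteDimensional.proper ℝ E
  obtain ⟨c, hc, hbound⟩ : ∃ c : ℝ, 0 < c ∧ ∀ q ∈ Q, c * ‖q‖ ≤ ‖L q‖ := by
    have hcomp : IsCompact (Q ∩ Metric.sphere 0 1) := (isCompact_sphere 0 1).inter_left hQ
    have hscale : ∀ q ∈ Q, q ≠ 0 → ‖q‖⁻¹ • q ∈ Q ∩ Metric.sphere 0 1 := fun q hq hq0 =>
      ⟨hsmul _ (by positivity) q hq, by simp [norm_smul, hq0]⟩
    rcases (Q ∩ Metric.sphere (0 : E) 1).eq_empty_or_nonempty with hempty | hnonempty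
    · refine ⟨1, one_pos, fun q hq => ?_⟩
      by_cases hq0 : q = 0
      · simp [hq0]
      · exact absurd (hscale q hq hq0) (by simp [hempty])
    · obtain ⟨q₀, hq₀, hmin⟩ := hcomp.exists_isMinOn hnonempty L.continuous.norm.continuousOn
      have hq₀_ne : q₀ ≠ 0 := by
        rintro rfl
        simpa using hq₀.2
      refine ⟨‖L q₀‖, norm_pos_iff.2 fun h => hq₀_ne (hker q₀ hq₀.1 h), fun q hq => ?_⟩
      by_cases hq0 : q = 0
      · simp [hq0]
      · have h : ‖L q₀‖ ≤ ‖L (‖q‖⁻¹ • q)‖ := hmin (hscale q hq hq0)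
        rw [map_smul, norm_smul, norm_inv, norm_norm, inv_mul_eq_div,
          le_div_iff₀ (norm_pos_iff.2 hq0)] at h
        exact h
  refine IsSeqClosed.isClosed fun w x hw hx => ?_
  choose q hq hqw using hw
  obtain ⟨B, hB⟩ := hx.norm.bddAbove_range
  have hball : ∀ m, q m ∈ Metric.closedBall (0 : E) (B / c) := fun m => by
    rw [mem_closedBall_zero_iff, le_div_iff₀' hc]
    exact (hbound _ (hq m)).trans (hqw m ▸ hB ⟨m, rfl⟩)
  obtain ⟨q', -, φ, hφ, hlim⟩ := (isCompact_closedBall (0 : E) (B / c)).tendsto_subseq hball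
  refine ⟨q', hQ.mem_of_tendsto hlim (.of_forall fun m => hq _), ?_⟩
  refine tendsto_nhds_unique ((L.continuous.tendsto q').comp hlim) ?_
  exact (hx.comp hφ.tendsto_atTop).congr fun m => (hqw (φ m)).symm

section SupportFunction

variable {d : ℕ} {A : Set (V d)}

lemma sfn_le_coe_iff {x : V d} {r : ℝ} : sfn A x ≤ r ↔ ∀ y ∈ A, vdot x y ≤ r := by
  simp [sfn, sSup_le_iff]

lemma le_sfn {y : V d} (hy : y ∈ A) (x : V d) : (vdot x y : EReal) ≤ sfn A x :=
  le_sSup ⟨y, hy, rfl⟩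

lemma sfn_mono {B : Set (V d)} (h : A ⊆ B) (x : V d) : sfn A x ≤ sfn B x :=
  sSup_le_sSup (Set.image_mono h)

lemma sfn_ne_bot (hA : A.Nonempty) (x : V d) : sfn A x ≠ ⊥ :=
  fun h => by simpa [h] using le_sfn hA.some_mem x

/-- A point lies in the domain of a support function iff the function is bounded there. -/
lemma mem_edom_sfn (hA : A.Nonempty) {x : V d} :
    x ∈ edom (sfn A) ↔ ∃ r : ℝ, ∀ y ∈ A, vdot x y ≤ r := by
  constructor
  · intro hx
    refine ⟨(sfn A x).toReal, sfn_le_coe_iff.1 ?_⟩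
    rw [EReal.coe_toReal hx (sfn_ne_bot hA x)]
  · rintro ⟨r, hr⟩
    exact ((sfn_le_coe_iff.2 hr).trans_lt (EReal.coe_lt_top r)).ne

lemma smul_mem_edom_sfn (hA : A.Nonempty) {c : ℝ} (hc : 0 ≤ c) {x : V d}
    (hx : x ∈ edom (sfn A)) : c • x ∈ edom (sfn A) := by
  obtain ⟨r, hr⟩ := (mem_edom_sfn hA).1 hx
  refine (mem_edom_sfn hA).2 ⟨c * r, fun y hy => ?_⟩
  rw [vdot_smul_left]
  exact mul_le_mul_of_nonneg_left (hr y hy) hc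

lemma convex_edom_sfn (hA : A.Nonempty) : Convex ℝ (edom (sfn A)) := by
  intro x hx x' hx' a b ha hb _
  obtain ⟨r, hr⟩ := (mem_edom_sfn hA).1 (smul_mem_edom_sfn hA ha hx)
  obtain ⟨r', hr'⟩ := (mem_edom_sfn hA).1 (smul_mem_edom_sfn hA hb hx')
  refine (mem_edom_sfn hA).2 ⟨r + r', fun y hy => ?_⟩
  rw [vdot_add_left]
  exact add_le_add (hr y hy) (hr' y hy)

lemma coe_mul_sfn_le (hA : A.Nonempty) {c s : ℝ} (hc : 0 ≤ c) {x : V d}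
    (h : ∀ y ∈ A, vdot (c • x) y ≤ s) : (c : EReal) * sfn A x ≤ s := by
  rcases hc.eq_or_lt with rfl | hc
  · simpa [vdot_zero_left] using h _ hA.some_mem
  · have hle : sfn A x ≤ ((s / c : ℝ) : EReal) := sfn_le_coe_iff.2 fun y hy => by
      rw [le_div_iff₀' hc, ← vdot_smul_left]
      exact h y hy
    refine (mul_le_mul_of_nonneg_left hle (EReal.coe_nonneg.2 hc.le)).trans_eq ?_
    rw [← EReal.coe_mul, mul_div_cancel₀ _ hc.ne']

/-- A closed convex set is the intersection of its supporting half-spaces. -/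
lemma mem_of_forall_vdot_le (hcl : IsClosed A) (hcv : Convex ℝ A) {y : V d}
    (h : ∀ (x : V d) (r : ℝ), (∀ a ∈ A, vdot x a ≤ r) → vdot x y ≤ r) : y ∈ A := by
  by_contra hy
  obtain ⟨f, u, hfA, hfy⟩ := geometric_hahn_banach_closed_point hcv hcl hy
  have hf : ∀ a, f a = vdot (fun j => f (Pi.single j 1)) a := fun a =>
    (linearMap_eq_vdot f.toLinearMap a).trans (dotProduct_comm _ _)
  refine hfy.not_ge ?_
  rw [hf]
  exact h _ u fun a ha => (hf a).symm.trans_le (hfA a ha).le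

end SupportFunction

lemma ereal_coe_sum {ι : Type*} (s : Finset ι) (f : ι → ℝ) :
    ((∑ k ∈ s, f k : ℝ) : EReal) = ∑ k ∈ s, (f k : EReal) := by
  induction s using Finset.cons_induction with
  | empty => simp
  | cons a s ha ih => simp [ih]

section CompactlyGenerated

variable {d : ℕ} {i : Fin d} {C : Set (V d)}

lemma CompactlyGen.coord_nonneg (hC : CompactlyGen i C) {x : V d} (hx : x ∈ C) : 0 ≤ x i := by
  rw [hC.2.2] at hx
  obtain ⟨c, hc, y, hy, rfl⟩ := hx
  simpa [hy.2] using hc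

lemma CompactlyGen.exists_eq_smul (hC : CompactlyGen i C) {x : V d} (hx : x ∈ C) :
    ∃ y ∈ sig i C, x = x i • y := by
  rw [hC.2.2] at hx
  obtain ⟨c, -, y, hy, rfl⟩ := hx
  exact ⟨y, hy, by simp [hy.2]⟩

lemma CompactlyGen.eq_zero (hC : CompactlyGen i C) {x : V d} (hx : x ∈ C) (h : x i = 0) :
    x = 0 := by
  obtain ⟨y, -, hy⟩ := hC.exists_eq_smul hx
  rw [hy, h, zero_smul]

end CompactlyGenerated

section Intersection

variable {d : ℕ} {ι : Type*} {A : ι → Set (V d)}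

/-- The product of the epigraphs of the support functions of the `A k`. -/
def epiProd (A : ι → Set (V d)) : Set (ι → V d × ℝ) :=
  {q | ∀ k, ∀ y ∈ A k, vdot (q k).1 y ≤ (q k).2}

lemma isClosed_epiProd : IsClosed (epiProd A) := by
  simp only [epiProd, Set.ofPred_forall]
  refine isClosed_iInter fun k => isClosed_iInter fun y => isClosed_iInter fun _ =>
    isClosed_le ((continuous_vdot_left y).comp ?_) ?_ <;> fun_prop

lemma smul_mem_epiProd (c : ℝ) (hc : 0 ≤ c) (q : ι → V d × ℝ) (hq : q ∈ epiProd A) :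
    c • q ∈ epiProd A := fun k y hy => by
  simpa [vdot_smul_left] using mul_le_mul_of_nonneg_left (hq k y hy) hc

lemma add_mem_epiProd {q q' : ι → V d × ℝ} (hq : q ∈ epiProd A) (hq' : q' ∈ epiProd A) :
    q + q' ∈ epiProd A := fun k y hy => by
  simpa [vdot_add_left] using add_le_add (hq k y hy) (hq' k y hy)

variable [Fintype ι]

lemma sfn_iInter_sum_le {α : ι → ℝ} (hα : ∀ k, 0 ≤ α k) (p : ι → V d) :
    sfn (⋂ k, A k) (∑ k, α k • p k) ≤ ∑ k, (α k : EReal) * sfn (A k) (p k) := by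
  refine sSup_le ?_
  rintro _ ⟨a, ha, rfl⟩
  simp only [vdot_sum_left, ereal_coe_sum, vdot_smul_left, EReal.coe_mul]
  exact Finset.sum_le_sum fun k _ => mul_le_mul_of_nonneg_left
    (le_sfn (Set.mem_iInter.1 ha k) _) (EReal.coe_nonneg.2 (hα k))

/-- The sum of the epigraphs of the support functions of the `A k`. -/
def epiSum (A : ι → Set (V d)) : Set (V d × ℝ) :=
  (∑ k, ContinuousLinearMap.proj k : (ι → V d × ℝ) →L[ℝ] V d × ℝ) '' epiProd A

lemma mem_epiSum_of_forall_le {k : ι} {z : V d} {s : ℝ} (h : ∀ y ∈ A k, vdot z y ≤ s) :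
    (z, s) ∈ epiSum A := by
  classical
  refine ⟨Pi.single k (z, s), fun l y hy => ?_, by simp⟩
  by_cases hl : l = k
  · subst hl
    simpa using h y hy
  · simp [hl, vdot_zero_left]

lemma convex_epiSum : Convex ℝ (epiSum A) := by
  refine Convex.is_linear_image (fun q hq q' hq' a b ha hb _ => ?_)
    (ContinuousLinearMap.toLinearMap _).isLinear
  exact add_mem_epiProd (smul_mem_epiProd a ha q hq) (smul_mem_epiProd b hb q' hq')

lemma smul_mem_epiSum {c : ℝ} (hc : 0 ≤ c) {w : V d × ℝ} (hw : w ∈ epiSum A) :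
    c • w ∈ epiSum A := by
  obtain ⟨q, hq, rfl⟩ := hw
  exact ⟨c • q, smul_mem_epiProd c hc q hq, map_smul _ c q⟩

lemma isClosed_epiSum {i : Fin d} (hne : ∀ k, (A k).Nonempty)
    (hdom : ∀ k, CompactlyGen i (edom (sfn (A k)))) : IsClosed (epiSum A) := by
  refine isClosed_image_of_cone (Q := epiProd A) isClosed_epiProd
    (fun c hc q hq => smul_mem_epiProd c hc q hq) _ fun q hq hsum => ?_
  have hmem : ∀ k, (q k).1 ∈ edom (sfn (A k)) := fun k => (mem_edom_sfn (hne k)).2 ⟨_, hq k⟩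
  have hfst : ∑ k, (q k).1 i = 0 := by
    simpa [Prod.fst_sum] using congrFun (congrArg Prod.fst hsum) i
  have hsnd : ∑ k, (q k).2 = 0 := by
    simpa [Prod.snd_sum] using congrArg Prod.snd hsum
  have hq1 : ∀ k, (q k).1 = 0 := fun k => (hdom k).eq_zero (hmem k) <|
    (Finset.sum_eq_zero_iff_of_nonneg fun k _ => (hdom k).coord_nonneg (hmem k)).1 hfst k
      (Finset.mem_univ k)
  have hq2 : ∀ k, 0 ≤ (q k).2 := fun k => by
    simpa [hq1 k, vdot_zero_left] using hq k _ (hne k).some_mem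
  funext k
  exact Prod.ext (hq1 k)
    ((Finset.sum_eq_zero_iff_of_nonneg fun k _ => hq2 k).1 hsnd k (Finset.mem_univ k))

/-- The epigraph of the support function of an intersection is contained in the sum of the
epigraphs as soon as that sum is closed. -/
lemma mem_epiSum_of_sfn_le [Nonempty ι] (hcl : ∀ k, IsClosed (A k)) (hcv : ∀ k, Convex ℝ (A k))
    (hInter : (⋂ k, A k).Nonempty) (hclosed : IsClosed (epiSum A)) {x : V d} {r : ℝ}
    (h : ∀ a ∈ ⋂ k, A k, vdot x a ≤ r) : (x, r) ∈ epiSum A := by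
  by_contra hx
  obtain ⟨f, u, hfx, hf⟩ := geometric_hahn_banach_point_closed convex_epiSum hclosed hx
  have hzero : (0 : V d × ℝ) ∈ epiSum A :=
    mem_epiSum_of_forall_le (k := Classical.arbitrary ι) (z := 0) (s := 0)
      fun y _ => (vdot_zero_left y).le
  have hu : u < 0 := by simpa using hf 0 hzero
  have hpos : ∀ w ∈ epiSum A, 0 ≤ f w := by
    intro w hw
    by_contra! hneg
    have hc : 0 ≤ u / f w := (div_pos_of_neg_of_neg hu hneg).le
    have := hf _ (smul_mem_epiSum hc hw)
    rw [map_smul, smul_eq_mul, div_mul_cancel₀ _ hneg.ne] at this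
    exact this.false
  obtain ⟨y, t, hyt⟩ : ∃ (y : V d) (t : ℝ), ∀ z s, f (z, s) = vdot z y + t * s := by
    refine ⟨fun j => f (Pi.single j 1, 0), f (0, 1), fun z s => ?_⟩
    refine Eq.trans ?_ (congrArg₂ (· + ·)
      (linearMap_eq_vdot (f.toLinearMap ∘ₗ LinearMap.inl ℝ (V d) ℝ) z) (mul_comm s _))
    rw [← smul_eq_mul, ← map_smul]
    simp [← map_add]
  have hx_neg : vdot x y + t * r < 0 := hyt x r ▸ hfx.trans hu
  have hepi : ∀ k z s, (∀ a ∈ A k, vdot z a ≤ s) → 0 ≤ vdot z y + t * s := fun k z s hzs =>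
    hyt z s ▸ hpos _ (mem_epiSum_of_forall_le hzs)
  have ht : 0 ≤ t := by
    simpa [vdot_zero_left] using hepi (Classical.arbitrary ι) 0 1
      fun a _ => by simp [vdot_zero_left]
  rcases ht.eq_or_lt with rfl | ht
  · obtain ⟨a, ha⟩ := hInter
    have hray : ∀ c : ℝ, 0 ≤ c → a - c • y ∈ ⋂ k, A k := fun c hc => Set.mem_iInter.2 fun k =>
      mem_of_forall_vdot_le (hcl k) (hcv k) fun z s hzs => by
        have h₁ := hepi k z s hzs
        have h₂ := hzs a (Set.mem_iInter.1 ha k)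
        rw [vdot_sub_right, vdot_smul_right]
        nlinarith
    have hxy : 0 < -vdot x y := by linarith
    have hxa := h a ha
    have := h _ (hray ((r - vdot x a + 1) / -vdot x y) (div_nonneg (by linarith) hxy.le))
    rw [vdot_sub_right, vdot_smul_right] at this
    have hcancel := div_mul_cancel₀ (r - vdot x a + 1) hxy.ne'
    linarith
  · have hmem : (-t⁻¹) • y ∈ ⋂ k, A k := Set.mem_iInter.2 fun k =>
      mem_of_forall_vdot_le (hcl k) (hcv k) fun z s hzs => by
        rw [vdot_smul_right]
        have := hepi k z s hzs
        field_simp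
        linarith
    have := h _ hmem
    rw [vdot_smul_right] at this
    field_simp at this
    linarith

/-- The epigraph of the support function of an intersection decomposes as the sum of the
epigraphs of the support functions. -/
lemma exists_decomposition [Nonempty ι] {i : Fin d} (hne : ∀ k, (A k).Nonempty)
    (hcl : ∀ k, IsClosed (A k)) (hcv : ∀ k, Convex ℝ (A k))
    (hdom : ∀ k, CompactlyGen i (edom (sfn (A k)))) (hInter : (⋂ k, A k).Nonempty)
    {x : V d} (hx : x ∈ edom (sfn (⋂ k, A k))) :
    ∃ (z : ι → V d) (s : ι → ℝ), (∀ k, ∀ y ∈ A k, vdot (z k) y ≤ s k) ∧ ∑ k, z k = x ∧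
      ∑ k, (s k : EReal) = sfn (⋂ k, A k) x := by
  have hr := EReal.coe_toReal hx (sfn_ne_bot hInter x)
  obtain ⟨q, hq, hsum⟩ := mem_epiSum_of_sfn_le hcl hcv hInter (isClosed_epiSum hne hdom)
    (sfn_le_coe_iff.1 hr.ge)
  refine ⟨fun k => (q k).1, fun k => (q k).2, hq, ?_, ?_⟩
  · simpa [Prod.fst_sum] using congrArg Prod.fst hsum
  · rw [← ereal_coe_sum, ← hr]
    simpa [Prod.snd_sum] using congrArg Prod.snd hsum

lemma sfn_iInter_eq_sum (hne : ∀ k, (A k).Nonempty) {x : V d} {z : ι → V d} {s : ι → ℝ}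
    (hzs : ∀ k, ∀ y ∈ A k, vdot (z k) y ≤ s k) (hz : ∑ k, z k = x)
    (hs : ∑ k, (s k : EReal) = sfn (⋂ k, A k) x) {α : ι → ℝ} (hα : ∀ k, 0 ≤ α k)
    {p : ι → V d} (hp : ∀ k, z k = α k • p k) :
    sfn (⋂ k, A k) x = ∑ k, (α k : EReal) * sfn (A k) (p k) := by
  apply le_antisymm
  · simpa only [← hp, hz] using sfn_iInter_sum_le (A := A) hα p
  · rw [← hs]
    exact Finset.sum_le_sum fun k _ => coe_mul_sfn_le (hne k) (hα k) (hp k ▸ hzs k)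

end Intersection

/-- key convexity lemma: if `A_1, …, A_n` are nonempty closed convex
sets in `ℝ^d` whose support functions have compactly `i`-generated domains, and
`A = ∩_k A_k ≠ ∅`, then `δ*_A = conv{δ*_{A_1}, …, δ*_{A_n}}`, with attained convex
combinations on `σ_i(dom δ*_A)`; moreover `dom δ*_A` is a compactly `i`-generated
cone and equals `conv[∪_k dom δ*_{A_k}]`. -/
theorem statement12 {d n : ℕ} (hd : 1 ≤ d) (hn : 1 ≤ n) (i : Fin d)
    (A : Fin n → Set (V d))
    (hne : ∀ k, (A k).Nonempty) (hcl : ∀ k, IsClosed (A k))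
    (hcv : ∀ k, Convex ℝ (A k))
    (hdom : ∀ k, CompactlyGen i (edom (sfn (A k))))
    (hInter : (⋂ k, A k).Nonempty) :
    (∀ x : V d, sfn (⋂ k, A k) x = fconvF Finset.univ (fun k => sfn (A k)) x) ∧
    (∀ x ∈ sig i (edom (sfn (⋂ k, A k))),
      ∃ (α : Fin n → ℝ) (p : Fin n → V d),
        (∀ k, 0 ≤ α k) ∧ (∑ k, α k) = 1 ∧
        (∀ k, p k ∈ sig i (edom (sfn (A k)))) ∧
        (∑ k, α k • p k) = x ∧
        sfn (⋂ k, A k) x = ∑ k, ((α k : ℝ) : EReal) * sfn (A k) (p k)) ∧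
    CompactlyGen i (edom (sfn (⋂ k, A k))) ∧
    edom (sfn (⋂ k, A k)) = convexHull ℝ (⋃ k, edom (sfn (A k))) := by
  have : Nonempty (Fin n) := ⟨⟨0, hn⟩⟩
  have hn0 : (n : ℝ) ≠ 0 := Nat.cast_ne_zero.2 (by omega)
  have hdec := fun x hx => exists_decomposition (x := x) hne hcl hcv hdom hInter hx
  have hsub : ∀ k, edom (sfn (A k)) ⊆ edom (sfn (⋂ k, A k)) := fun k x hx =>
    ne_top_of_le_ne_top hx (sfn_mono (Set.iInter_subset A k) x)
  have hconvex := convex_edom_sfn hInter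
  have hattain : ∀ x ∈ sig i (edom (sfn (⋂ k, A k))),
      ∃ (α : Fin n → ℝ) (p : Fin n → V d),
        (∀ k, 0 ≤ α k) ∧ (∑ k, α k) = 1 ∧
        (∀ k, p k ∈ sig i (edom (sfn (A k)))) ∧
        (∑ k, α k • p k) = x ∧
        sfn (⋂ k, A k) x = ∑ k, ((α k : ℝ) : EReal) * sfn (A k) (p k) := by
    rintro x ⟨hx, hxi⟩
    obtain ⟨z, s, hzs, hz, hs⟩ := hdec x hx
    have hmem : ∀ k, z k ∈ edom (sfn (A k)) := fun k => (mem_edom_sfn (hne k)).2 ⟨_, hzs k⟩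
    choose p hp hzp using fun k => (hdom k).exists_eq_smul (hmem k)
    have hα : ∀ k, 0 ≤ z k i := fun k => (hdom k).coord_nonneg (hmem k)
    refine ⟨fun k => z k i, p, hα, ?_, hp, ?_, sfn_iInter_eq_sum hne hzs hz hs hα hzp⟩
    · rw [← hxi, ← hz, Finset.sum_apply]
    · simpa only [← hzp] using hz
  refine ⟨fun x => le_antisymm (le_sInf ?_) ?_, hattain, ⟨?_, ?_, ?_⟩, ?_⟩
  · rintro _ ⟨α, p, hα, -, rfl, rfl⟩
    exact sfn_iInter_sum_le hα p
  · by_cases hx : x ∈ edom (sfn (⋂ k, A k))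
    · obtain ⟨z, s, hzs, hz, hs⟩ := hdec x hx
      have hα : ∀ _ : Fin n, (0 : ℝ) ≤ (n : ℝ)⁻¹ := fun _ => by positivity
      have hp : ∀ k, z k = (n : ℝ)⁻¹ • (n : ℝ) • z k := fun k => by
        rw [smul_smul, inv_mul_cancel₀ hn0, one_smul]
      refine sInf_le ⟨fun _ => (n : ℝ)⁻¹, fun k => (n : ℝ) • z k, hα, by simp [hn0], ?_,
        sfn_iInter_eq_sum hne hzs hz hs hα hp⟩
      simpa only [← hp] using hz
    · rw [not_not.1 hx]
      exact le_top
  · obtain ⟨x, hx⟩ := (hdom ⟨0, hn⟩).1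
    exact ⟨x, hsub _ hx.1, hx.2⟩
  · have himage : sig i (edom (sfn (⋂ k, A k))) =
        (fun q : (Fin n → ℝ) × (Fin n → V d) => ∑ k, q.1 k • q.2 k) ''
          (stdSimplex ℝ (Fin n) ×ˢ Set.univ.pi fun k => sig i (edom (sfn (A k)))) := by
      ext x
      constructor
      · intro hx
        obtain ⟨α, p, hα, hα1, hp, hsum, -⟩ := hattain x hx
        exact ⟨(α, p), ⟨⟨hα, hα1⟩, fun k _ => hp k⟩, hsum⟩
      · rintro ⟨⟨α, p⟩, ⟨⟨hα, hα1⟩, hp⟩, rfl⟩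
        refine ⟨hconvex.sum_mem (fun k _ => hα k) hα1
          fun k _ => hsub k (hp k (Set.mem_univ k)).1, ?_⟩
        have hpi : ∀ k, p k i = 1 := fun k => (hp k (Set.mem_univ k)).2
        simpa [hpi] using hα1
    rw [himage]
    exact ((isCompact_stdSimplex ℝ (Fin n)).prod (isCompact_univ_pi fun k => (hdom k).2.1)).image
      (by fun_prop)
  · ext x
    constructor
    · intro hx
      obtain ⟨z, s, hzs, rfl, -⟩ := hdec x hx
      have hmem : ∀ k, z k ∈ edom (sfn (A k)) := fun k => (mem_edom_sfn (hne k)).2 ⟨_, hzs k⟩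
      have hα : ∀ k, 0 ≤ z k i := fun k => (hdom k).coord_nonneg (hmem k)
      have hxi : 0 ≤ (∑ k, z k) i := by
        simpa using Finset.sum_nonneg fun k _ => hα k
      rcases hxi.eq_or_lt with h0 | hpos
      · obtain ⟨y, hy⟩ := (hdom ⟨0, hn⟩).1
        refine ⟨0, le_rfl, y, ⟨hsub _ hy.1, hy.2⟩, ?_⟩
        rw [zero_smul]
        rw [Finset.sum_apply, eq_comm, Finset.sum_eq_zero_iff_of_nonneg fun k _ => hα k] at h0
        exact Finset.sum_eq_zero fun k hk => (hdom k).eq_zero (hmem k) (h0 k hk)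
      · refine ⟨_, hxi, ((∑ k, z k) i)⁻¹ • ∑ k, z k,
          ⟨smul_mem_edom_sfn hInter (inv_nonneg.2 hxi) hx, ?_⟩, ?_⟩
        · rw [Pi.smul_apply, smul_eq_mul, inv_mul_cancel₀ hpos.ne']
        · rw [smul_smul, mul_inv_cancel₀ hpos.ne', one_smul]
    · rintro ⟨c, hc, y, hy, rfl⟩
      exact smul_mem_edom_sfn hInter hc hy.1
  · refine Set.Subset.antisymm (fun x hx => ?_) (convexHull_min (Set.iUnion_subset hsub) hconvex)
    obtain ⟨z, s, hzs, rfl, -⟩ := hdec x hx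
    have hp : ∀ k, (n : ℝ) • z k ∈ convexHull ℝ (⋃ k, edom (sfn (A k))) := fun k =>
      subset_convexHull ℝ _ <| Set.mem_iUnion.2
        ⟨k, smul_mem_edom_sfn (hne k) n.cast_nonneg ((mem_edom_sfn (hne k)).2 ⟨_, hzs k⟩)⟩
    have := (convex_convexHull ℝ (⋃ k, edom (sfn (A k)))).sum_mem (t := Finset.univ)
      (w := fun _ => (n : ℝ)⁻¹) (fun _ _ => by positivity) (by simp [hn0]) fun k _ => hp k
    simpa [smul_smul, hn0] using this

end RZpaper
end

section
/- Let (ξ, E) be an option. A self-financing strategy y ∈ Φ superhedges (ξ, E) for the seller if and only if y_t ∈ Z^a_t for every t = 0,…,T. Moreover, for every z ∈ Z^a_0 there exists y ∈ Φ superhedging (ξ, E) for the seller with y_0 = z. -/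
open Finset MeasureTheory
open scoped Pointwise

namespace RZpaper

section Node

variable {Ω : Type*} {m m' : MeasurableSpace Ω} {ω ω' : Ω}

lemma mem_node_self (m : MeasurableSpace Ω) (ω : Ω) : ω ∈ node m ω :=
  fun _ _ h => h

lemma mem_node_symm (h : ω' ∈ node m ω) : ω ∈ node m ω' := by
  intro A hA hω'
  by_contra hω
  exact h Aᶜ hA.compl hω hω'

lemma mem_node_trans {ω'' : Ω} (h : ω' ∈ node m ω) (h' : ω'' ∈ node m ω') :
    ω'' ∈ node m ω :=
  fun A hA hω => h' A hA (h A hA hω)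

lemma node_eq_of_mem (h : ω' ∈ node m ω) : node m ω' = node m ω :=
  Set.Subset.antisymm (fun _ hx => mem_node_trans h hx)
    (fun _ hx => mem_node_trans (mem_node_symm h) hx)

lemma node_anti (hm : m ≤ m') (ω : Ω) : node m' ω ⊆ node m ω :=
  fun _ h A hA => h A (hm A hA)

lemma eq_of_mem_node {β : Type*} [MeasurableSpace β] [MeasurableSingletonClass β]
    {f : Ω → β} (hf : Measurable[m] f) (h : ω' ∈ node m ω) : f ω' = f ω :=
  h (f ⁻¹' {f ω}) (hf (measurableSet_singleton _)) rfl

lemma measurableSet_node [Finite Ω] (m : MeasurableSpace Ω) (ω : Ω) :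
    MeasurableSet[m] (node m ω) := by
  have h : node m ω = ⋂ A ∈ {A : Set Ω | MeasurableSet[m] A ∧ ω ∈ A}, A := by
    ext x
    simp [node]
  rw [h]
  exact MeasurableSet.biInter (Set.to_countable _) fun A hA => hA.1

lemma measurable_of_const_on_nodes [Finite Ω] {β : Type*} [MeasurableSpace β] {f : Ω → β}
    (hf : ∀ ω, ∀ ω' ∈ node m ω, f ω' = f ω) : Measurable[m] f := by
  intro s _
  have h : f ⁻¹' s = ⋃ ω ∈ f ⁻¹' s, node m ω := by
    ext x
    simp only [Set.mem_iUnion, exists_prop]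
    refine ⟨fun hx => ⟨x, hx, mem_node_self m x⟩, ?_⟩
    rintro ⟨ω, hω, hx⟩
    rw [Set.mem_preimage, hf ω x hx]
    exact hω
  rw [h]
  exact MeasurableSet.biUnion (Set.to_countable _) fun ω _ => measurableSet_node m ω

end Node

namespace Market

variable {Ω : Type*} [Fintype Ω] {T d : ℕ} (M : Market Ω T d) {E : ℕ → Set Ω}
  {ξ : ℕ → Ω → V d}

lemma solvency_eq_of_mem_node {t : ℕ} (ht : t ≤ T) {ω ω' : Ω} (h : ω' ∈ node (M.F t) ω) :
    M.solvency t ω' = M.solvency t ω := by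
  have hpi : M.pi t ω' = M.pi t ω := eq_of_mem_node (M.pi_adapted t ht) h
  simp only [solvency, hpi]

lemma mem_Ua {t : ℕ} {ω : Ω} {v : V d} :
    v ∈ M.Ua E ξ t ω ↔ (ω ∈ E t → v - ξ t ω ∈ M.solvency t ω) := by
  classical
  by_cases h : ω ∈ E t
  · simp [Ua, h, neg_add_eq_sub]
  · simp [Ua, h]

lemma Za_last : M.Za E ξ T = M.Ua E ξ T := by
  simp [Za, ZaAux]

lemma Za_of_lt {t : ℕ} (ht : t < T) (ω : Ω) :
    M.Za E ξ t ω = M.Ua E ξ t ω ∩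
      ({v | ∀ ω' ∈ node (M.F t) ω, v ∈ M.Za E ξ (t + 1) ω'} + M.solvency t ω) := by
  obtain ⟨k, rfl⟩ : ∃ k, T = t + (k + 1) := ⟨T - t - 1, by omega⟩
  have h1 : t + (k + 1) - t = k + 1 := by omega
  have h2 : t + (k + 1) - (t + 1) = k := by omega
  have h3 : t + (k + 1) - (k + 1) = t := by omega
  simp only [Za, h1, h2, ZaAux, h3]

lemma Za_subset_Ua {t : ℕ} (ht : t ≤ T) (ω : Ω) : M.Za E ξ t ω ⊆ M.Ua E ξ t ω := by
  rcases ht.lt_or_eq with h | rfl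
  · rw [M.Za_of_lt h]
    exact Set.inter_subset_left
  · rw [Za_last]

/-- Every exercise opportunity is realised by a consistent stopping time: exercise at `t` on
`E t`, and at the last opportunity elsewhere. -/
lemma exists_consStop (hE : M.IsPolicy E) {t : ℕ} (ht : t ≤ T) :
    ∃ τ : Ω → ℕ, M.ConsStop E τ ∧ ∀ ω ∈ E t, τ ω = t := by
  classical
  obtain ⟨hE₁, hE₂, hE₃⟩ := hE
  let σ : Ω → ℕ := fun ω => Nat.findGreatest (fun s => ω ∈ E s) T
  have hσT : ∀ ω, σ ω ≤ T := fun ω => Nat.findGreatest_le T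
  have hσE : ∀ ω, ω ∈ E (σ ω) := by
    intro ω
    have h : ω ∈ ⋃ t ∈ Finset.range (T + 1), E t := hE₃ ▸ Set.mem_univ ω
    simp only [Set.mem_iUnion, Finset.mem_range, exists_prop] at h
    obtain ⟨s, hs, hωs⟩ := h
    exact Nat.findGreatest_spec (P := fun s => ω ∈ E s) (by omega : s ≤ T) hωs
  have hσmax : ∀ ω s, s ≤ T → ω ∈ E s → s ≤ σ ω := fun ω s hs hω =>
    Nat.le_findGreatest hs hω
  have hσ : ∀ s ≤ T, MeasurableSet[M.F s] {ω | σ ω = s} := by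
    intro s hs
    have h : {ω | σ ω = s} = E s \ ⋃ r ∈ Finset.Icc (s + 1) T, E r := by
      ext ω
      simp only [Set.mem_ofPred_eq, Set.mem_sdiff, Set.mem_iUnion, Finset.mem_Icc, exists_prop,
        not_exists, not_and]
      constructor
      · rintro rfl
        refine ⟨hσE ω, fun r hr hω => ?_⟩
        have := hσmax ω r hr.2 hω
        omega
      · rintro ⟨hω, hlast⟩
        by_contra hne
        have := hσmax ω s hs hω
        exact hlast (σ ω) ⟨by omega, hσT ω⟩ (hσE ω)
    rw [h]
    refine (hE₁ s hs).diff ?_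
    rcases hs.lt_or_eq with hlt | rfl
    · exact hE₂ s hlt
    · simp
  refine ⟨fun ω => if ω ∈ E t then t else σ ω, ⟨⟨fun ω => ?_, fun s => ?_⟩, ?_⟩, ?_⟩
  · dsimp only
    split_ifs
    exacts [ht, hσT ω]
  · rcases lt_trichotomy s t with hst | rfl | hst
    · have h : {ω | (if ω ∈ E t then t else σ ω) = s} = {ω | σ ω = s} := by
        ext ω
        by_cases hω : ω ∈ E t
        · have := hσmax ω t ht hω
          simp only [Set.mem_ofPred_eq, hω, if_true]
          omega
        · simp [hω]
      rw [h]
      exact hσ s (by omega)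
    · have h : {ω | (if ω ∈ E s then s else σ ω) = s} = E s := by
        ext ω
        by_cases hω : ω ∈ E s
        · simp [hω]
        · have : σ ω ≠ s := fun h => hω (h ▸ hσE ω)
          simp [hω, this]
      rw [h]
      exact hE₁ s ht
    · have h : {ω | (if ω ∈ E t then t else σ ω) = s} = {ω | σ ω = s} \ E t := by
        ext ω
        by_cases hω : ω ∈ E t
        · simp [hω, hst.ne]
        · simp [hω]
      rw [h]
      rcases le_or_gt s T with hsT | hsT
      · exact (hσ s hsT).diff (M.F_mono t s hst.le _ (hE₁ t ht))
      · have h' : {ω | σ ω = s} = ∅ := by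
          ext ω
          have := hσT ω
          simp only [Set.mem_ofPred_eq, Set.mem_empty_iff_false, iff_false]
          omega
        rw [h', Set.empty_sdiff]
        exact @MeasurableSet.empty _ (M.F s)
  · rintro s ω rfl
    by_cases hω : ω ∈ E t
    · simp [hω]
    · simp [hω, hσE ω]
  · intro ω hω
    simp [hω]

lemma mem_Ua_of_sellerCovers {y : ℕ → Ω → V d} (hE : M.IsPolicy E) (h : M.SellerCovers E ξ y)
    {t : ℕ} (ht : t ≤ T) (ω : Ω) : y t ω ∈ M.Ua E ξ t ω := by
  rw [mem_Ua]
  intro hω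
  obtain ⟨τ, hτ, hτt⟩ := M.exists_consStop hE ht
  simpa [hτt ω hω] using h τ hτ ω

lemma mem_Za_of_sellerCovers {y : ℕ → Ω → V d} (hE : M.IsPolicy E) (hy : M.SelfFinancing y)
    (h : M.SellerCovers E ξ y) {t : ℕ} (ht : t ≤ T) : ∀ ω, y t ω ∈ M.Za E ξ t ω := by
  induction ht using Nat.decreasingInduction with
  | self =>
    rw [Za_last]
    exact M.mem_Ua_of_sellerCovers hE h le_rfl
  | of_succ t ht ih =>
    intro ω
    rw [M.Za_of_lt ht]
    refine ⟨M.mem_Ua_of_sellerCovers hE h ht.le ω, Set.mem_add.2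
      ⟨y (t + 1) ω, fun ω' hω' => ?_, y t ω - y (t + 1) ω, hy.2 t ht ω, by abel⟩⟩
    rw [← eq_of_mem_node (hy.1 (t + 1) ht) hω']
    exact ih ω'

lemma sellerCovers_of_mem_Za {y : ℕ → Ω → V d}
    (h : ∀ t, t ≤ T → ∀ ω, y t ω ∈ M.Za E ξ t ω) : M.SellerCovers E ξ y := by
  intro τ hτ ω
  have hT := hτ.1.1 ω
  exact M.mem_Ua.1 (M.Za_subset_Ua hT ω (h _ hT ω)) (hτ.2 (τ ω) rfl)

/-- The portfolios reachable from `v` at time `t` in state `ω` that lie in `Z^a_{t+1}` on the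
whole node. -/
def sellerSuccessors (E : ℕ → Set Ω) (ξ : ℕ → Ω → V d) (t : ℕ) (ω : Ω) (v : V d) : Set (V d) :=
  {w | (∀ ω' ∈ node (M.F t) ω, w ∈ M.Za E ξ (t + 1) ω') ∧ v - w ∈ M.solvency t ω}

lemma sellerSuccessors_nonempty {t : ℕ} (ht : t < T) {ω : Ω} {v : V d}
    (hv : v ∈ M.Za E ξ t ω) : (M.sellerSuccessors E ξ t ω v).Nonempty := by
  rw [M.Za_of_lt ht] at hv
  obtain ⟨w, hw, s, hs, rfl⟩ := Set.mem_add.1 hv.2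
  exact ⟨w, hw, by simpa using hs⟩

lemma sellerSuccessors_eq_of_mem_node {t : ℕ} (ht : t ≤ T) {ω ω' : Ω}
    (h : ω' ∈ node (M.F t) ω) (v : V d) :
    M.sellerSuccessors E ξ t ω' v = M.sellerSuccessors E ξ t ω v := by
  simp only [sellerSuccessors, node_eq_of_mem h, M.solvency_eq_of_mem_node ht h]

/-- A strategy started at `z` that selects its successive portfolios from `sellerSuccessors`. -/
noncomputable def sellerStrategy (M : Market Ω T d) (E : ℕ → Set Ω) (ξ : ℕ → Ω → V d) (z : V d) : ℕ → Ω → V d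
  | 0 => fun _ => z
  | t + 1 => fun ω =>
      Classical.epsilon (· ∈ M.sellerSuccessors E ξ t ω (sellerStrategy M E ξ z t ω))

lemma sellerStrategy_measurable (z : V d) {t : ℕ} (ht : t ≤ T) :
    Measurable[M.F (t - 1)] (M.sellerStrategy E ξ z t) := by
  induction t with
  | zero => exact measurable_const
  | succ t ih =>
    refine measurable_of_const_on_nodes fun ω ω' h => ?_
    have hy : M.sellerStrategy E ξ z t ω' = M.sellerStrategy E ξ z t ω :=
      eq_of_mem_node (ih (by omega)) (node_anti (M.F_mono _ _ (by omega)) ω h)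
    simp only [sellerStrategy, hy]
    rw [M.sellerSuccessors_eq_of_mem_node (t := t) (by omega) h]

lemma sellerStrategy_succ_mem {z : V d} {t : ℕ} (ht : t < T) {ω : Ω}
    (h : M.sellerStrategy E ξ z t ω ∈ M.Za E ξ t ω) :
    M.sellerStrategy E ξ z (t + 1) ω ∈
      M.sellerSuccessors E ξ t ω (M.sellerStrategy E ξ z t ω) :=
  Classical.epsilon_spec (M.sellerSuccessors_nonempty ht h)

lemma sellerStrategy_mem_Za {z : V d} (hz : z ∈ M.Za0 E ξ) {t : ℕ} (ht : t ≤ T) (ω : Ω) :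
    M.sellerStrategy E ξ z t ω ∈ M.Za E ξ t ω := by
  induction t with
  | zero => exact hz ω
  | succ t ih => exact (M.sellerStrategy_succ_mem ht (ih (by omega))).1 ω (mem_node_self _ ω)

lemma sellerStrategy_selfFinancing {z : V d} (hz : z ∈ M.Za0 E ξ) :
    M.SelfFinancing (M.sellerStrategy E ξ z) :=
  ⟨fun _ ht => M.sellerStrategy_measurable z ht, fun _ ht ω =>
    (M.sellerStrategy_succ_mem ht (M.sellerStrategy_mem_Za hz ht.le ω)).2⟩

end Market

/-- a self-financing strategy `y` superhedges `(ξ, E)` for the seller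
iff `y_t ∈ Z^a_t` for all `t ≤ T`; moreover every `z ∈ Z^a_0` is the initial value of
some seller superhedging strategy. -/
theorem statement18 {Ω : Type*} [Fintype Ω] [Nonempty Ω] {T d : ℕ}
    (M : Market Ω T d) (E : ℕ → Set Ω) (hE : M.IsPolicy E)
    (ξ : ℕ → Ω → V d) (hξ : M.Adapted ξ) :
    (∀ y : ℕ → Ω → V d, M.SelfFinancing y →
      (M.SellerCovers E ξ y ↔ ∀ t, t ≤ T → ∀ ω, y t ω ∈ M.Za E ξ t ω)) ∧
    ∀ z ∈ M.Za0 E ξ, ∃ y, M.SellerHedge E ξ y ∧ ∀ ω, y 0 ω = z := by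
  refine ⟨fun y hy => ⟨fun h t ht => M.mem_Za_of_sellerCovers hE hy h ht,
    M.sellerCovers_of_mem_Za⟩, fun z hz => ?_⟩
  exact ⟨M.sellerStrategy E ξ z, ⟨M.sellerStrategy_selfFinancing hz,
    M.sellerCovers_of_mem_Za fun t ht ω => M.sellerStrategy_mem_Za hz ht ω⟩, fun _ => rfl⟩

end RZpaper
end
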